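/- If the Dyck path a is a product (concatenation) of pyramids, then for every k ≥ 1, f(d u^k a) = ζ^{k+1}(a, u^{|a|}), i.e., f(d u^k a) equals the number of multichains of length k+1 from a to the maximum path u^{|a|} in the lattice of binary paths of length |a|. -/

import Mathlib

/-- A binary path is a list of steps: `true` = upstep `u`, `false` = downstep `d`. -/
abbrev BinPath := List Bool

/-- `ht P k` is the height of the `k`-th point of the path `P` (the point reached
after the first `k` steps). -/
def ht (P : BinPath) (k : ℕ) : ℤ :=
  ((P.take k).map (fun b => if b then (1 : ℤ) else -1)).sum

/-- The lattice order on binary paths of the same length: `P ≤ Q` iff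
`hᵢ(P) ≤ hᵢ(Q)` for all `i`. -/
def pathLe (P Q : BinPath) : Prop :=
  P.length = Q.length ∧ ∀ k, ht P k ≤ ht Q k

def pathLt (P Q : BinPath) : Prop := pathLe P Q ∧ P ≠ Q

/-- The maximum path `1ₙ = uⁿ`. -/
def maxPath (n : ℕ) : BinPath := List.replicate n true

/-- Step `i` (0-based) of `P` is a downstep whose endpoint is a valley, i.e. it is
followed by an upstep or it is the last step of `P`. -/
def isValley (P : BinPath) (i : ℕ) : Prop :=
  i < P.length ∧ P.getD i true = false ∧ P.getD (i + 1) true = true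

/-- The number of valleys of `P`. -/
def numValleys (P : BinPath) : ℕ :=
  ((Finset.range P.length).filter
    (fun i => P.getD i true = false ∧ P.getD (i + 1) true = true)).card

/-- The filling of `P`: every valley of `P` is turned into a peak
(each occurrence `du` whose middle point is a valley becomes `ud`, and a final
valley-`d` becomes `u`). -/
def fill (P : BinPath) : BinPath :=
  List.ofFn (fun i : Fin P.length =>
    if P.get i then P.getD (i.1 - 1) true else P.getD (i.1 + 1) true)

/-- The degree of `P`: the least `k` such that the `k`-fold iterated filling
of `P` is the maximum path. -/
noncomputable def degree (P : BinPath) : ℕ :=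
  sInf {k | fill^[k] P = maxPath P.length}

/-- `fPath P` is the number of chains from `P` to the maximum path `1_{|P|}` of
length `degree P` having small intervals. -/
noncomputable def fPath (P : BinPath) : ℕ :=
  Set.ncard {c : ℕ → BinPath |
    c 0 = P ∧ (∀ i, degree P ≤ i → c i = maxPath P.length) ∧
    ∀ i < degree P, pathLt (c i) (c (i + 1)) ∧ pathLe (c (i + 1)) (fill (c i))}

/-- Height of the lowest valley of `P`. -/
noncomputable def lv (P : BinPath) : ℤ :=
  sInf {h : ℤ | ∃ i, isValley P i ∧ ht P (i + 1) = h}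

/-- Height of the highest valley of `P`. -/
noncomputable def hv (P : BinPath) : ℤ :=
  sSup {h : ℤ | ∃ i, isValley P i ∧ ht P (i + 1) = h}

noncomputable def hvNat (P : BinPath) : ℕ := (hv P).toNat

/-- `P′`: every low valley of `P` is turned into a peak. -/
noncomputable def lowFill (P : BinPath) : BinPath :=
  List.ofFn (fun i : Fin P.length =>
    if P.get i then
      (if P.getD (i.1 - 1) true = false ∧ ht P i.1 = lv P then false else true)
    else
      (if P.getD (i.1 + 1) true = true ∧ ht P (i.1 + 1) = lv P then true else false))

/-- `P*`: every valley of `P` is turned into a peak, except the last one when `P`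
ends with a downstep. -/
def starFill (P : BinPath) : BinPath :=
  List.ofFn (fun i : Fin P.length =>
    if i.1 + 1 = P.length ∧ P.get i = false then false
    else if P.get i then P.getD (i.1 - 1) true else P.getD (i.1 + 1) true)

/-- A Dyck path: starts and ends at height 0 and lies weakly above height 0. -/
def IsDyck (P : BinPath) : Prop := ht P P.length = 0 ∧ ∀ k, 0 ≤ ht P k

/-- A Dyck prefix: a prefix of a Dyck path. -/
def IsDyckPrefix (P : BinPath) : Prop := ∃ Q : BinPath, IsDyck (P ++ Q)

/-- A Dyck suffix: a suffix of a Dyck path. -/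
def IsDyckSuffix (P : BinPath) : Prop := ∃ Q : BinPath, IsDyck (Q ++ P)

/-- The pyramid `u^m d^m`. -/
def pyramid (m : ℕ) : BinPath := List.replicate m true ++ List.replicate m false

/-- Cardinality of the interval `[P, Q]` in the lattice of binary paths. -/
noncomputable def intervalCard (P Q : BinPath) : ℕ :=
  Set.ncard {R : BinPath | pathLe P R ∧ pathLe R Q}

/-- `I(s) = |[s, u^{|s|/2} d^{|s|/2}]|`. -/
noncomputable def Ifun (s : BinPath) : ℕ := intervalCard s (pyramid (s.length / 2))

/-- `J(P) = |[P, u^{|P|}]|`. -/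
noncomputable def Jfun (P : BinPath) : ℕ := intervalCard P (maxPath P.length)

/-- `P` and `Q` have exactly the same valleys at every height at most `m`. -/
def sameValleysUpTo (P Q : BinPath) (m : ℤ) : Prop :=
  ∀ (i : ℕ) (t : ℤ), t ≤ m →
    ((isValley P i ∧ ht P (i + 1) = t) ↔ (isValley Q i ∧ ht Q (i + 1) = t))

/-- A multichain of Dyck paths of type `V` from `a` to `s`: it has length
`h = hv(a)` and for every `j ∈ [h]` its `(j-1)`-st and `j`-th members have the
same valleys at every height at most `h - j`.  (The function `σ` is frozen from
index `h` on, so that such multichains are counted correctly.) -/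
def IsVChain (a s : BinPath) (σ : ℕ → BinPath) : Prop :=
  σ 0 = a ∧ (∀ j, hvNat a ≤ j → σ j = s) ∧ (∀ j, IsDyck (σ j)) ∧
  (∀ j < hvNat a, pathLe (σ j) (σ (j + 1))) ∧
  (∀ j, 1 ≤ j → j ≤ hvNat a →
    sameValleysUpTo (σ (j - 1)) (σ j) ((hvNat a : ℤ) - (j : ℤ)))

/-- `V(a,s)`: the number of `a`–`s` multichains of type `V`. -/
noncomputable def VPath (a s : BinPath) : ℕ :=
  Set.ncard {σ : ℕ → BinPath | IsVChain a s σ}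

/-- `ζ^k(P,Q)`: the number of `P`–`Q` multichains of length `k`. -/
noncomputable def zetaPow (k : ℕ) (P Q : BinPath) : ℕ :=
  Set.ncard {c : ℕ → BinPath |
    c 0 = P ∧ (∀ i, k ≤ i → c i = Q) ∧ ∀ i < k, pathLe (c i) (c (i + 1))}

/-- The join of two paths of the same length (pointwise max of heights). -/
def pathSup (P Q : BinPath) : BinPath :=
  List.ofFn (fun i : Fin P.length =>
    decide (max (ht P i.1) (ht Q i.1) < max (ht P (i.1 + 1)) (ht Q (i.1 + 1))))

/-- The meet of two paths of the same length (pointwise min of heights). -/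
def pathInf (P Q : BinPath) : BinPath :=
  List.ofFn (fun i : Fin P.length =>
    decide (min (ht P i.1) (ht Q i.1) < min (ht P (i.1 + 1)) (ht Q (i.1 + 1))))

/-- `Q` covers `P` in the lattice of binary paths. -/
def pathCovBy (P Q : BinPath) : Prop :=
  pathLt P Q ∧ ∀ R : BinPath, pathLt P R → pathLt R Q → False

/-- `l(P,Q) = (1/2)·Σᵢ (hᵢ(Q) − hᵢ(P))`. -/
def lpq (P Q : BinPath) : ℕ :=
  ((∑ i ∈ Finset.range P.length, (ht Q (i + 1) - ht P (i + 1))) / 2).toNat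

/-- Convolution in the incidence algebra of the lattice of binary paths. -/
noncomputable def conv (F G : BinPath → BinPath → ℤ) : BinPath → BinPath → ℤ :=
  fun P Q => ∑ᶠ (R : BinPath) (_ : pathLe P R ∧ pathLe R Q), F P R * G R Q

/-- The delta function of the incidence algebra. -/
def deltaFun : BinPath → BinPath → ℤ := fun P Q => if P = Q then 1 else 0

/-- `μ^k`: the `k`-th convolution power of `μ` (`μ^0` is the delta function). -/
noncomputable def muPow (mu : BinPath → BinPath → ℤ) (k : ℕ) : BinPath → BinPath → ℤ :=
  (conv mu)^[k] deltaFun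

/-! ### Heights of binary paths -/

lemma ht_zero (P : BinPath) : ht P 0 = 0 := by simp [ht]

lemma ht_succ (P : BinPath) {j : ℕ} (hj : j < P.length) :
    ht P (j + 1) = ht P j + if P[j] then 1 else -1 := by
  simp only [ht, List.take_add_one, List.getElem?_eq_getElem hj, Option.toList_some,
    List.map_append, List.sum_append, List.map_cons, List.map_nil, List.sum_singleton]

lemma ht_succ_cases (P : BinPath) {j : ℕ} (hj : j < P.length) :
    ht P (j + 1) = ht P j + 1 ∨ ht P (j + 1) = ht P j - 1 := by
  rw [ht_succ P hj]
  split_ifs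
  · exact Or.inl rfl
  · exact Or.inr rfl

lemma ht_of_length_le (P : BinPath) {j : ℕ} (hj : P.length ≤ j) : ht P j = ht P P.length := by
  simp [ht, List.take_of_length_le hj]

lemma ht_bounds (P : BinPath) {j : ℕ} (hj : j ≤ P.length) :
    -(j : ℤ) ≤ ht P j ∧ ht P j ≤ j ∧ (ht P j - j) % 2 = 0 := by
  induction j with
  | zero => simp [ht_zero]
  | succ j ih =>
    have := ih (by omega)
    have := ht_succ_cases P (j := j) (by omega)
    push_cast
    omega

lemma pathLe_iff {P Q : BinPath} :
    pathLe P Q ↔ P.length = Q.length ∧ ∀ j ≤ P.length, ht P j ≤ ht Q j := by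
  refine and_congr_right fun hl => ⟨fun h j _ => h j, fun h j => ?_⟩
  rcases le_total j P.length with hj | hj
  · exact h j hj
  · rw [ht_of_length_le P hj, ht_of_length_le Q (hl ▸ hj), ← hl]
    exact h _ le_rfl

lemma pathLe_refl (P : BinPath) : pathLe P P := ⟨rfl, fun _ => le_rfl⟩

lemma pathLe_trans {P Q R : BinPath} (h₁ : pathLe P Q) (h₂ : pathLe Q R) : pathLe P R :=
  ⟨h₁.1.trans h₂.1, fun j => (h₁.2 j).trans (h₂.2 j)⟩

lemma eq_of_ht_eq {P Q : BinPath} (hl : P.length = Q.length)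
    (h : ∀ j ≤ P.length, ht P j = ht Q j) : P = Q := by
  refine List.ext_getElem hl fun j hj hj' => ?_
  have h₁ := ht_succ P hj
  have h₂ := ht_succ Q hj'
  rw [h _ hj, h _ hj.le, h₂] at h₁
  cases hP : P[j] <;> cases hQ : Q[j] <;> simp [hP, hQ] at h₁ ⊢

lemma length_maxPath (n : ℕ) : (maxPath n).length = n := by simp [maxPath]

lemma ht_maxPath {n j : ℕ} (hj : j ≤ n) : ht (maxPath n) j = j := by
  simp [ht, maxPath, List.take_replicate, hj]

lemma eq_maxPath {P : BinPath} (h : ∀ j ≤ P.length, (j : ℤ) ≤ ht P j) :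
    P = maxPath P.length :=
  eq_of_ht_eq (length_maxPath _).symm fun j hj => by
    rw [ht_maxPath hj]
    exact le_antisymm (ht_bounds P hj).2.1 (h j hj)

lemma ht_append_left (P Q : BinPath) {j : ℕ} (hj : j ≤ P.length) : ht (P ++ Q) j = ht P j := by
  simp [ht, List.take_append_of_le_length hj]

lemma ht_append_right (P Q : BinPath) (j : ℕ) :
    ht (P ++ Q) (P.length + j) = ht P P.length + ht Q j := by
  simp [ht, List.take_length_add_append]

/-- A family of half-lines that is compatible with unit steps is the family of sets of
heights lying below some binary path. -/
lemma exists_path_of_predicate (n : ℕ) (R : ℕ → ℤ → Prop)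
    (hbot : ∀ (j : ℕ) (y : ℤ), j ≤ n → y ≤ -j → R j y) (htop : ∀ y, 0 < y → ¬ R 0 y)
    (hr : ∀ j y, j < n → R j y → R (j + 1) (y - 1))
    (hl : ∀ j y, j < n → R (j + 1) y → R j (y - 1)) :
    ∃ p : BinPath, p.length = n ∧
      ∀ j ≤ n, ∀ y : ℤ, (y - j) % 2 = 0 → (y ≤ ht p j ↔ R j y) := by
  classical
  have hdown : ∀ j ≤ n, ∀ (t : ℕ) y, R j y → R j (y - 2 * t) := by
    intro j hj t
    induction t with
    | zero => simp
    | succ t ih =>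
      intro y hy
      rcases j with _ | j
      · refine hbot _ _ hj ?_
        have : ¬ 0 < y := fun h => htop y h hy
        push_cast
        omega
      · have h := hr j _ (by omega) (hl j _ (by omega) (ih y hy))
        convert h using 1
        push_cast
        ring
  have hsharp : ∀ m ≤ n, ∃ p : BinPath, p.length = m ∧
      ∀ j ≤ m, R j (ht p j) ∧ ¬ R j (ht p j + 2) := by
    intro m
    induction m with
    | zero =>
      refine fun _ => ⟨[], rfl, fun j hj => ?_⟩
      obtain rfl : j = 0 := by omega
      rw [ht_zero]
      exact ⟨hbot _ _ (by omega) (by simp), htop _ (by norm_num)⟩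
    | succ m ih =>
      intro hm
      obtain ⟨p, hp, h⟩ := ih (by omega)
      have hm' := h m le_rfl
      have hlast : ∀ b : Bool,
          ht (p ++ [b]) (m + 1) = ht p m + if b then 1 else -1 := by
        intro b
        rw [← hp, ht_append_right]
        cases b <;> simp [ht]
      refine ⟨p ++ [decide (R (m + 1) (ht p m + 1))], by simp [hp], fun j hj => ?_⟩
      rcases Nat.lt_or_ge m j with hj' | hj'
      · obtain rfl : j = m + 1 := by omega
        rw [hlast]
        by_cases hR : R (m + 1) (ht p m + 1)
        · simp only [hR, decide_true, if_true, true_and]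
          intro hR'
          apply hm'.2
          convert hl m _ (by omega) hR' using 1
          ring
        · simp only [hR, decide_false, Bool.false_eq_true, if_false]
          refine ⟨hr m _ (by omega) hm'.1, ?_⟩
          convert hR using 2
          ring
      · rw [ht_append_left _ _ (by omega)]
        exact h j hj'
  obtain ⟨p, hp, h⟩ := hsharp n le_rfl
  refine ⟨p, hp, fun j hj y hy => ⟨fun hle => ?_, fun hR => ?_⟩⟩
  · have hpar := (ht_bounds p (hp ▸ hj : j ≤ p.length)).2.2
    convert hdown j hj ((ht p j - y) / 2).toNat _ (h j hj).1 using 1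
    omega
  · by_contra hlt
    have hpar := (ht_bounds p (hp ▸ hj : j ≤ p.length)).2.2
    apply (h j hj).2
    convert hdown j hj ((y - ht p j) / 2 - 1).toNat _ hR using 1
    omega

/-! ### The filling and small intervals -/

lemma length_fill (P : BinPath) : (fill P).length = P.length := by simp [fill]

lemma getElem_fill (P : BinPath) {j : ℕ} (hj : j < P.length) :
    (fill P)[j]'(by rwa [length_fill]) =
      if P[j] then P.getD (j - 1) true else P.getD (j + 1) true := by
  simp [fill]

lemma ht_fill_succ (P : BinPath) {j : ℕ} (hj : j < P.length) :
    ht (fill P) (j + 1) =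
      ht P (j + 1) + if P[j] = false ∧ P.getD (j + 1) true = true then 2 else 0 := by
  induction j with
  | zero =>
    rw [ht_succ _ (by rwa [length_fill]), getElem_fill P hj, ht_succ P hj, ht_zero, ht_zero]
    cases h : P[0] <;> cases h' : P.getD 1 true <;> simp_all
  | succ j ih =>
    rw [ht_succ _ (by rwa [length_fill]), getElem_fill P hj, ht_succ P hj, ih (by omega)]
    have h₀ : P.getD j true = P[j] := by simp [show j < P.length by omega]
    have h₁ : P.getD (j + 1) true = P[j + 1] := by simp [hj]
    simp only [Nat.add_sub_cancel, h₀, h₁]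
    cases P[j] <;> cases P[j + 1] <;> cases P.getD (j + 1 + 1) true <;> simp <;> ring

lemma pathLe_fill_iff {P Q : BinPath} :
    pathLe Q (fill P) ↔ Q.length = P.length ∧
      ∀ j < P.length, ht Q j ≤ ht P (j + 1) + 1 ∧ ht Q (j + 1) ≤ ht P j + 1 := by
  rw [pathLe_iff, length_fill]
  refine and_congr_right fun hl => ?_
  rw [hl]
  constructor
  · intro h j hj
    constructor
    · rcases j with _ | j
      · have := ht_succ_cases P hj
        rw [ht_zero] at *
        omega
      · have h₁ := h (j + 1) hj.le
        rw [ht_fill_succ P (by omega)] at h₁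
        have h₂ := ht_succ P hj
        have h₃ : P.getD (j + 1) true = P[j + 1] := by simp [hj]
        rw [h₃] at h₁
        cases hP : P[j + 1] <;> simp [hP] at h₁ h₂ <;> omega
    · have h₁ := h (j + 1) hj
      rw [ht_fill_succ P hj, ht_succ P hj] at h₁
      cases hP : P[j] <;> simp [hP] at h₁ <;> omega
  · intro h j hj
    rcases j with _ | j
    · simp [ht_zero]
    · rw [ht_fill_succ P (by omega)]
      have h₁ := (h j (by omega)).2
      have h₂ := ht_succ P (j := j) (by omega)
      split_ifs with hv
      · simp [hv.1] at h₂
        omega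
      · cases hP : P[j]
        · have hn : P.getD (j + 1) true = false := by simpa [hP] using hv
          have hj' : j + 1 < P.length := by
            by_contra hge
            rw [List.getD_eq_default _ _ (by omega)] at hn
            exact absurd hn (by simp)
          have h₃ := (h (j + 1) hj').1
          have h₄ := ht_succ P hj'
          have h₅ : P.getD (j + 1) true = P[j + 1] := by simp [hj']
          rw [h₅] at hn
          simp [hn] at h₄
          omega
        · simp [hP] at h₂
          omega

lemma fill_mono {P Q : BinPath} (h : pathLe P Q) : pathLe (fill P) (fill Q) := by
  obtain ⟨hl, hle⟩ := h
  have := (pathLe_fill_iff.1 (pathLe_refl (fill P))).2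
  refine pathLe_fill_iff.2 ⟨(length_fill P).trans hl, fun j hj => ?_⟩
  have h₁ := this j (hl ▸ hj)
  have h₂ := hle j
  have h₃ := hle (j + 1)
  omega

lemma length_iterate_fill (P : BinPath) (i : ℕ) : (fill^[i] P).length = P.length := by
  induction i with
  | zero => rfl
  | succ i ih => rw [Function.iterate_succ_apply', length_fill, ih]

/-! ### Products of pyramids -/

/-- The path stays weakly above height `0`, ends at height `0`, and all its valleys have
height at most `0`: each point of positive height has a lower neighbour. -/
structure IsLowValleyed (a : BinPath) : Prop where
  nonneg : ∀ j ≤ a.length, 0 ≤ ht a j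
  ends : ht a a.length = 0
  lower : ∀ j ≤ a.length, 0 < ht a j →
    ∃ j' ≤ a.length, (j' = j + 1 ∨ j = j' + 1) ∧ ht a j' = ht a j - 1

lemma ht_pyramid_left {m j : ℕ} (hj : j ≤ m) : ht (pyramid m) j = j := by
  rw [pyramid, ht_append_left _ _ (by simpa using hj)]
  exact ht_maxPath hj

lemma ht_pyramid_right {m t : ℕ} (ht' : t ≤ m) : ht (pyramid m) (m + t) = m - t := by
  have h := ht_append_right (List.replicate m true) (List.replicate m false) t
  have hm : ht (List.replicate m true) m = m := ht_maxPath le_rfl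
  rw [List.length_replicate, hm] at h
  rw [pyramid, h]
  simp [ht, List.take_replicate, ht']
  ring

lemma IsLowValleyed.pyramid (m : ℕ) : IsLowValleyed (pyramid m) := by
  have hl : (_root_.pyramid m).length = m + m := by simp [_root_.pyramid]
  refine ⟨fun j hj => ?_, ?_, fun j hj hpos => ?_⟩
  · rcases le_total j m with h | h
    · rw [ht_pyramid_left h]
      positivity
    · obtain ⟨t, rfl⟩ := Nat.exists_eq_add_of_le h
      rw [ht_pyramid_right (by omega)]
      omega
  · rw [hl, ht_pyramid_right le_rfl]
    simp
  · rcases le_or_gt m j with h | h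
    · obtain ⟨t, rfl⟩ := Nat.exists_eq_add_of_le h
      rw [ht_pyramid_right (by omega)] at hpos ⊢
      refine ⟨m + (t + 1), by omega, Or.inl rfl, ?_⟩
      rw [ht_pyramid_right (by omega)]
      push_cast
      ring
    · rw [ht_pyramid_left h.le] at hpos ⊢
      refine ⟨j - 1, by omega, Or.inr (by omega), ?_⟩
      rw [ht_pyramid_left (by omega)]
      omega

lemma IsLowValleyed.append {p q : BinPath} (hp : IsLowValleyed p) (hq : IsLowValleyed q) :
    IsLowValleyed (p ++ q) := by
  have hr : ∀ t, ht (p ++ q) (p.length + t) = ht q t := fun t => by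
    rw [ht_append_right, hp.ends, zero_add]
  refine ⟨fun j hj => ?_, ?_, fun j hj hpos => ?_⟩
  · rw [List.length_append] at hj
    rcases le_total j p.length with h | h
    · rw [ht_append_left _ _ h]
      exact hp.nonneg j h
    · obtain ⟨t, rfl⟩ := Nat.exists_eq_add_of_le h
      rw [hr]
      exact hq.nonneg t (by omega)
  · rw [List.length_append, hr, hq.ends]
  · rw [List.length_append] at hj ⊢
    rcases le_total j p.length with h | h
    · rw [ht_append_left _ _ h] at hpos ⊢
      obtain ⟨j', hj', hadj, heq⟩ := hp.lower j h hpos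
      exact ⟨j', by omega, hadj, by rw [ht_append_left _ _ hj', heq]⟩
    · obtain ⟨t, rfl⟩ := Nat.exists_eq_add_of_le h
      rw [hr] at hpos ⊢
      obtain ⟨t', ht', hadj, heq⟩ := hq.lower t (by omega) hpos
      exact ⟨p.length + t', by omega, by omega, by rw [hr, heq]⟩

lemma isLowValleyed_flatten_pyramids (L : List ℕ) :
    IsLowValleyed (L.map pyramid).flatten := by
  induction L with
  | nil => exact IsLowValleyed.pyramid 0
  | cons m L ih => exact (IsLowValleyed.pyramid m).append ih

/-! ### Chains with small intervals reaching the maximum after `|P|` steps -/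

/-- Multichains with small intervals from `P` that reach the maximum at time `|P|`. -/
structure IsSmallChain (P : BinPath) (c : ℕ → BinPath) : Prop where
  zero : c 0 = P
  top : ∀ i, P.length ≤ i → c i = maxPath P.length
  le_succ : ∀ i, pathLe (c i) (c (i + 1))
  small : ∀ i, pathLe (c (i + 1)) (fill (c i))

lemma pathLe_maxPath_fill (n : ℕ) : pathLe (maxPath n) (fill (maxPath n)) := by
  refine pathLe_fill_iff.2 ⟨rfl, fun j hj => ?_⟩
  rw [length_maxPath] at hj
  rw [ht_maxPath hj.le, ht_maxPath hj]
  omega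

lemma ht_mono_of_pathLe_succ {c : ℕ → BinPath} (h : ∀ i, pathLe (c i) (c (i + 1))) (j : ℕ) :
    Monotone fun i => ht (c i) j :=
  monotone_nat_of_le_succ fun i => (h i).2 j

namespace IsSmallChain

variable {P : BinPath} {c : ℕ → BinPath}

lemma length_eq (hc : IsSmallChain P c) (i : ℕ) : (c i).length = P.length := by
  induction i with
  | zero => rw [hc.zero]
  | succ i ih => rw [← (hc.le_succ i).1, ih]

lemma hop (hc : IsSmallChain P c) (i : ℕ) {j : ℕ} (hj : j < P.length) :
    ht (c (i + 1)) j ≤ ht (c i) (j + 1) + 1 ∧ ht (c (i + 1)) (j + 1) ≤ ht (c i) j + 1 :=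
  (pathLe_fill_iff.1 (hc.small i)).2 j (by rwa [hc.length_eq])

lemma ht_bounds (hc : IsSmallChain P c) (i : ℕ) {j : ℕ} (hj : j ≤ P.length) :
    -(j : ℤ) ≤ ht (c i) j ∧ ht (c i) j ≤ j ∧ (ht (c i) j - j) % 2 = 0 :=
  _root_.ht_bounds _ (by rwa [hc.length_eq])

lemma ht_mono (hc : IsSmallChain P c) (j : ℕ) : Monotone fun i => ht (c i) j :=
  ht_mono_of_pathLe_succ hc.le_succ j

lemma ht_le_of_lt (hc : IsSmallChain P c) (hP : ht P 1 = -1) :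
    ∀ {i j : ℕ}, i < j → j ≤ P.length → ht (c i) j ≤ j - 2
  | 0, j + 1, _, hj => by
    rw [hc.zero]
    clear hc
    induction j with
    | zero => simp [hP]
    | succ j ih =>
      have := ih (by omega) (by omega)
      have := ht_succ_cases P (j := j + 1) (by omega)
      push_cast at *
      omega
  | i + 1, j + 1, hij, hj => by
    have := ht_le_of_lt hc hP (i := i) (j := j) (by omega) (by omega)
    have := (hc.hop i (j := j) (by omega)).2
    push_cast
    omega

lemma ht_self (hc : IsSmallChain P c) {i : ℕ} (hi : i ≤ P.length) :
    ht (c i) i = i := by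
  refine le_antisymm (hc.ht_bounds i hi).2.1 ?_
  induction hi using Nat.decreasingInduction with
  | of_succ i hi ih =>
    have := (hc.hop i hi).2
    push_cast at ih
    omega
  | self => rw [hc.top _ le_rfl, ht_maxPath le_rfl]

lemma ht_of_le (hc : IsSmallChain P c) {i j : ℕ} (hij : j ≤ i)
    (hj : j ≤ P.length) : ht (c i) j = j := by
  have h₁ := hc.ht_self hj
  have h₂ := hc.ht_mono j hij
  have h₃ := (hc.ht_bounds i hj).2.1
  simp only at h₂
  omega

lemma sub_two_le_ht (hc : IsSmallChain P c) {i j : ℕ} (hij : j ≤ i + 2)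
    (hj : j ≤ P.length) : (j : ℤ) - 2 ≤ ht (c i) j := by
  rcases j with _ | _ | j
  · simp [ht_zero]
  · have := (hc.ht_bounds i hj).1
    push_cast at *
    omega
  · have h₁ := (hc.hop j (j := j + 1) (by omega)).1
    have h₂ := hc.ht_self (i := j + 1) (by omega)
    have h₃ := hc.ht_mono (j + 2) (show j ≤ i by omega)
    simp only [add_assoc, Nat.reduceAdd] at *
    push_cast at *
    omega

lemma degree_eq (hc : IsSmallChain P c) (hP : ht P 1 = -1) : degree P = P.length := by
  have hlow : ∀ i, pathLe (c i) (fill^[i] P) := by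
    intro i
    induction i with
    | zero => exact hc.zero ▸ pathLe_refl _
    | succ i ih =>
      rw [Function.iterate_succ_apply']
      exact pathLe_trans (hc.small i) (fill_mono ih)
  have hup : ∀ i, i < P.length → ht (fill^[i] P) (i + 1) ≤ i - 1 := by
    intro i
    induction i with
    | zero => simp [hP]
    | succ i ih =>
      intro hi
      rw [Function.iterate_succ_apply']
      have h := ((pathLe_fill_iff.1 (pathLe_refl (fill (fill^[i] P)))).2 (i + 1)
        (by rwa [length_iterate_fill])).2
      have := ih (by omega)
      push_cast
      omega
  refine le_antisymm (Nat.sInf_le ?_) (le_csInf ⟨P.length, ?_⟩ fun i hi => ?_)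
  on_goal 3 =>
    by_contra hlt
    have h := hup i (by omega)
    rw [show fill^[i] P = _ from hi, ht_maxPath (by omega)] at h
    push_cast at h
    omega
  all_goals
    have h := (hlow P.length).2
    have heq := eq_maxPath (P := fill^[P.length] P) fun j hj => by
      have := h j
      rw [length_iterate_fill] at hj
      rwa [hc.top _ le_rfl, ht_maxPath hj] at this
    rwa [length_iterate_fill] at heq

lemma ne_succ (hc : IsSmallChain P c) (hP : ht P 1 = -1) {i : ℕ} (hi : i < P.length) :
    c i ≠ c (i + 1) := by
  intro h
  have h₁ := hc.ht_self (i := i + 1) hi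
  have h₂ := hc.ht_le_of_lt hP (i := i) (j := i + 1) (by omega) hi
  rw [← h] at h₁
  push_cast at *
  omega

end IsSmallChain

lemma fPath_eq_ncard_isSmallChain {P : BinPath} (hP : ht P 1 = -1)
    (hex : ∃ c, IsSmallChain P c) : fPath P = Set.ncard {c | IsSmallChain P c} := by
  obtain ⟨c₀, hc₀⟩ := hex
  rw [fPath, hc₀.degree_eq hP]
  congr 1
  ext c
  constructor
  · rintro ⟨h₀, htop, hstep⟩
    refine ⟨h₀, htop, fun i => ?_, fun i => ?_⟩ <;> rcases lt_or_ge i P.length with hi | hi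
    · exact (hstep i hi).1.1
    · rw [htop i hi, htop (i + 1) (by omega)]
      exact pathLe_refl _
    · exact (hstep i hi).2
    · rw [htop i hi, htop (i + 1) (by omega)]
      exact pathLe_maxPath_fill _
  · intro hc
    exact ⟨hc.zero, hc.top, fun i hi => ⟨⟨hc.le_succ i, hc.ne_succ hP hi⟩, hc.small i⟩⟩

/-- Multichains of length `m` from `a` to the maximum. -/
structure IsMaxMultichain (m : ℕ) (a : BinPath) (e : ℕ → BinPath) : Prop where
  zero : e 0 = a
  top : ∀ i, m ≤ i → e i = maxPath a.length
  le_succ : ∀ i, pathLe (e i) (e (i + 1))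

lemma zetaPow_maxPath_eq_ncard (m : ℕ) (a : BinPath) :
    zetaPow m a (maxPath a.length) = Set.ncard {e | IsMaxMultichain m a e} := by
  rw [zetaPow]
  congr 1
  ext e
  constructor
  · rintro ⟨h₀, htop, hstep⟩
    refine ⟨h₀, htop, fun i => ?_⟩
    rcases lt_or_ge i m with hi | hi
    · exact hstep i hi
    · rw [htop i hi, htop (i + 1) (by omega)]
      exact pathLe_refl _
  · intro h
    exact ⟨h.zero, h.top, fun i _ => h.le_succ i⟩

namespace IsMaxMultichain

variable {m : ℕ} {a : BinPath} {e : ℕ → BinPath}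

lemma length_eq (he : IsMaxMultichain m a e) (i : ℕ) : (e i).length = a.length := by
  induction i with
  | zero => rw [he.zero]
  | succ i ih => rw [← (he.le_succ i).1, ih]

lemma ht_bounds (he : IsMaxMultichain m a e) (i : ℕ) {j : ℕ} (hj : j ≤ a.length) :
    -(j : ℤ) ≤ ht (e i) j ∧ ht (e i) j ≤ j ∧ (ht (e i) j - j) % 2 = 0 :=
  _root_.ht_bounds _ (by rwa [he.length_eq])

lemma ht_mono (he : IsMaxMultichain m a e) (j : ℕ) : Monotone fun i => ht (e i) j :=
  ht_mono_of_pathLe_succ he.le_succ j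

lemma ht_top (he : IsMaxMultichain m a e) {i j : ℕ} (hi : m ≤ i) (hj : j ≤ a.length) :
    ht (e i) j = j := by
  rw [he.top i hi, ht_maxPath hj]

lemma le_ht (he : IsMaxMultichain m a e) (i j : ℕ) : ht a j ≤ ht (e i) j := by
  simpa only [he.zero] using he.ht_mono j (Nat.zero_le i)

lemma ht_succ_cases (he : IsMaxMultichain m a e) (i : ℕ) {j : ℕ} (hj : j < a.length) :
    ht (e i) (j + 1) = ht (e i) j + 1 ∨ ht (e i) (j + 1) = ht (e i) j - 1 :=
  _root_.ht_succ_cases _ (by rwa [he.length_eq])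

end IsMaxMultichain

/-! ### Small-interval chains from `d uᵏ a` and multichains from `a` -/

/-- The path `d uᵏ a`. -/
abbrev prependDown (k : ℕ) (a : BinPath) : BinPath := false :: (List.replicate k true ++ a)

lemma length_prependDown (k : ℕ) (a : BinPath) :
    (prependDown k a).length = a.length + k + 1 := by
  simp [add_comm]

lemma ht_prependDown_succ (k : ℕ) (a : BinPath) {j : ℕ} (hj : j ≤ k) :
    ht (prependDown k a) (j + 1) = j - 1 := by
  have h : ht (List.replicate k true ++ a) j = j := by
    rw [ht_append_left _ _ (by simpa using hj)]
    exact ht_maxPath hj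
  simp only [ht, List.take_succ_cons, List.map_cons, List.sum_cons] at h ⊢
  rw [h]
  simp
  ring

lemma ht_prependDown_right (k : ℕ) (a : BinPath) (j : ℕ) :
    ht (prependDown k a) (j + k + 1) = ht a j + k - 1 := by
  have h := ht_append_right (false :: List.replicate k true) a j
  have hl : (false :: List.replicate k true).length = k + 1 := by simp
  have h₁ := ht_prependDown_succ k [] le_rfl
  rw [prependDown, List.append_nil] at h₁
  rw [hl, h₁] at h
  rw [show j + k + 1 = k + 1 + j by ring, prependDown, ← List.cons_append, h]
  ring

lemma ht_prependDown_one (k : ℕ) (a : BinPath) : ht (prependDown k a) 1 = -1 := by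
  simpa using ht_prependDown_succ k a (Nat.zero_le k)

/-- A cell of the region above `a`, with top at abscissa `j` and height `y`, that is present
in the `i`-th path of the chain `c` is present in the `(i - y + 2)`-nd path of `e`. -/
def Corresponds (k : ℕ) (a : BinPath) (c e : ℕ → BinPath) : Prop :=
  ∀ j ≤ a.length, ∀ y : ℤ, y ≤ j → (y - j) % 2 = 0 → ∀ s : ℤ,
    (y + k - 1 ≤ ht (c (y + s - 2).toNat) (j + k + 1) ↔ y ≤ ht (e s.toNat) j)

section Correspondence

variable {k : ℕ} {a : BinPath} {c c' e e' : ℕ → BinPath}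

lemma Corresponds.right_unique (he : IsMaxMultichain (k + 1) a e)
    (he' : IsMaxMultichain (k + 1) a e')
    (h : Corresponds k a c e) (h' : Corresponds k a c e') : e = e' := by
  funext s
  refine eq_of_ht_eq (by rw [he.length_eq, he'.length_eq]) fun j hj => ?_
  rw [he.length_eq] at hj
  have hb := he.ht_bounds s hj
  have hb' := he'.ht_bounds s hj
  have h₁ := ((h j hj _ hb.2.1 hb.2.2 s).symm.trans (h' j hj _ hb.2.1 hb.2.2 s)).1
  have h₂ := ((h' j hj _ hb'.2.1 hb'.2.2 s).symm.trans (h j hj _ hb'.2.1 hb'.2.2 s)).1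
  rw [Int.toNat_natCast] at h₁ h₂
  exact le_antisymm (h₁ le_rfl) (h₂ le_rfl)

lemma Corresponds.ht_le (hc : IsSmallChain (prependDown k a) c)
    (hc' : IsSmallChain (prependDown k a) c')
    (h : Corresponds k a c e) (h' : Corresponds k a c' e) (i : ℕ) {j : ℕ}
    (hj : j ≤ a.length + k + 1) : ht (c i) j ≤ ht (c' i) j := by
  have hP := ht_prependDown_one k a
  have hj' : j ≤ (prependDown k a).length := by rwa [length_prependDown]
  rcases le_or_gt j i with hij | hij
  · rw [hc.ht_of_le hij hj', hc'.ht_of_le hij hj']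
  · have hlt := hc.ht_le_of_lt hP hij hj'
    rcases le_or_gt j k with hjk | hjk
    · obtain ⟨j, rfl⟩ := Nat.exists_eq_add_one_of_ne_zero (show j ≠ 0 by omega)
      have h₁ := ht_prependDown_succ k a (j := j) (by omega)
      have h₂ := hc'.ht_mono (j + 1) (Nat.zero_le i)
      simp only [hc'.zero] at h₂
      push_cast at hlt ⊢
      omega
    · obtain ⟨t, rfl⟩ : ∃ t, j = t + k + 1 := ⟨j - k - 1, by omega⟩
      have hpar := (hc.ht_bounds i hj').2.2
      set Y := ht (c i) (t + k + 1) with hY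
      push_cast at hlt hpar
      have h₁ := ((h t (by omega) (Y - k + 1) (by omega) (by omega) (i - Y + k + 1)).trans
        (h' t (by omega) (Y - k + 1) (by omega) (by omega) (i - Y + k + 1)).symm).1
      rw [show (Y - k + 1 + (i - Y + k + 1) - 2).toNat = i by omega,
        show Y - k + 1 + k - 1 = Y by ring] at h₁
      exact h₁ le_rfl

lemma Corresponds.left_unique (hc : IsSmallChain (prependDown k a) c)
    (hc' : IsSmallChain (prependDown k a) c')
    (h : Corresponds k a c e) (h' : Corresponds k a c' e) : c = c' := by
  funext i
  refine eq_of_ht_eq (by rw [hc.length_eq, hc'.length_eq]) fun j hj => ?_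
  rw [hc.length_eq, length_prependDown] at hj
  exact le_antisymm (h.ht_le hc hc' h' i hj) (h'.ht_le hc' hc h i hj)

/-- Each cell above `a` with top of height `y` is added at time at least `y - 1`. -/
lemma IsSmallChain.ht_le_max (ha : IsLowValleyed a) (hc : IsSmallChain (prependDown k a) c)
    (i : ℕ) : ∀ {j : ℕ}, j ≤ a.length + k + 1 →
      ht (c i) j ≤ max (ht (prependDown k a) j) (i + k) := by
  have hl := length_prependDown k a
  induction i with
  | zero => exact fun _ => hc.zero ▸ le_max_left _ _
  | succ i ih =>
    intro j hj
    rcases le_or_gt j k with hjk | hjk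
    · have := (hc.ht_bounds (i + 1) (j := j) (by omega)).2.1
      exact le_max_of_le_right (by push_cast; omega)
    · obtain ⟨t, rfl⟩ : ∃ t, j = t + k + 1 := ⟨j - k - 1, by omega⟩
      rcases le_or_gt (ht a t) 0 with hz | hz
      · have h₁ := (hc.hop i (j := t + k) (by omega)).2
        have h₂ := ih (j := t + k) (by omega)
        have h₃ := ht_succ_cases (prependDown k a) (j := t + k) (by omega)
        have h₄ := ht_prependDown_right k a t
        push_cast
        omega
      · obtain ⟨t', ht', hadj, heq⟩ := ha.lower t (by omega) hz
        have h₂ := ih (j := t' + k + 1) (by omega)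
        rw [ht_prependDown_right, heq] at h₂
        rw [ht_prependDown_right]
        rcases hadj with rfl | rfl
        · have h₁ := (hc.hop i (j := t + k + 1) (by omega)).1
          rw [show t + k + 1 + 1 = t + 1 + k + 1 by ring] at h₁
          push_cast
          omega
        · have h₁ := (hc.hop i (j := t' + k + 1) (by omega)).2
          rw [show t' + k + 1 + 1 = t' + 1 + k + 1 by ring] at h₁
          push_cast
          omega

lemma exists_corresponds_right (ha : IsLowValleyed a) (hc : IsSmallChain (prependDown k a) c) :
    ∃ e, IsMaxMultichain (k + 1) a e ∧ Corresponds k a c e := by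
  have hl := length_prependDown k a
  have hge : ∀ i j, ht a j + k - 1 ≤ ht (c i) (j + k + 1) := fun i j => by
    have := hc.ht_mono (j + k + 1) (Nat.zero_le i)
    simpa only [hc.zero, ht_prependDown_right] using this
  have hhop : ∀ (s y : ℤ) (j : ℕ), j < a.length →
      (y + k - 1 ≤ ht (c (y + s - 2).toNat) (j + k + 1) →
        y - 1 + k - 1 ≤ ht (c (y - 1 + s - 2).toNat) (j + 1 + k + 1)) ∧
      (y + k - 1 ≤ ht (c (y + s - 2).toNat) (j + 1 + k + 1) →
        y - 1 + k - 1 ≤ ht (c (y - 1 + s - 2).toNat) (j + k + 1)) := by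
    intro s y j hj
    rcases le_or_gt (y + s - 2) 0 with h | h
    · rw [show (y + s - 2).toNat = 0 by omega, show (y - 1 + s - 2).toNat = 0 by omega, hc.zero,
        ht_prependDown_right, ht_prependDown_right]
      have := ht_succ_cases a hj
      omega
    · have hhop := hc.hop (y - 1 + s - 2).toNat (j := j + k + 1) (by omega)
      rw [show (y - 1 + s - 2).toNat + 1 = (y + s - 2).toNat by omega,
        show j + k + 1 + 1 = j + 1 + k + 1 by ring] at hhop
      omega
  have hex : ∀ s : ℤ, ∃ p : BinPath, p.length = a.length ∧ ∀ j ≤ a.length, ∀ y : ℤ,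
      (y - j) % 2 = 0 →
        (y ≤ ht p j ↔ y ≤ j ∧ y + k - 1 ≤ ht (c (y + s - 2).toNat) (j + k + 1)) := by
    intro s
    refine exists_path_of_predicate a.length _ (fun j y hj hy => ⟨by omega, ?_⟩)
      (fun y hy h => absurd h.1 (by push_cast; omega))
      (fun j y hj h => ⟨by have := h.1; push_cast; omega, (hhop s y j hj).1 h.2⟩)
      (fun j y hj h => ⟨by have := h.1; push_cast at this; omega, (hhop s y j hj).2 h.2⟩)
    have h₁ := hge (y + s - 2).toNat j
    have h₂ := (ht_bounds a hj).1
    omega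
  choose E hElen hE using hex
  have hEnonpos : ∀ s : ℤ, s ≤ 0 → E s = a := by
    intro s hs
    refine eq_of_ht_eq (hElen s) fun j hj => ?_
    rw [hElen] at hj
    have hpar := (ht_bounds (E s) (j := j) (by rwa [hElen])).2.2
    have hb := ht_bounds a hj
    apply le_antisymm
    · obtain ⟨-, h₂⟩ := (hE s j hj _ hpar).1 le_rfl
      rcases le_or_gt (ht (E s) j + s - 2) 0 with h | h
      · rw [show (ht (E s) j + s - 2).toNat = 0 by omega, hc.zero, ht_prependDown_right] at h₂
        omega
      · have h₃ := hc.ht_le_max ha (ht (E s) j + s - 2).toNat (j := j + k + 1) (by omega)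
        rw [ht_prependDown_right] at h₃
        omega
    · exact (hE s j hj _ hb.2.2).2 ⟨hb.2.1, hge _ _⟩
  refine ⟨fun s => E s, ⟨hEnonpos _ le_rfl, fun s hs => ?_, fun s => ?_⟩, ?_⟩
  · rw [← hElen s]
    refine eq_maxPath fun j hj => ?_
    rw [hElen] at hj
    refine (hE s j hj j (by simp)).2 ⟨le_rfl, ?_⟩
    have := hc.sub_two_le_ht (i := ((j : ℤ) + s - 2).toNat) (j := j + k + 1) (by omega)
      (by omega)
    push_cast at this
    omega
  · refine pathLe_iff.2 ⟨by rw [hElen, hElen], fun j hj => ?_⟩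
    have hpar := (ht_bounds (E s) hj).2.2
    rw [hElen] at hj
    obtain ⟨h₁, h₂⟩ := (hE s j hj _ hpar).1 le_rfl
    exact (hE _ j hj _ hpar).2 ⟨h₁, h₂.trans (hc.ht_mono _ (by omega))⟩
  · intro j hj y hy hpar s
    rcases le_or_gt s 0 with h | h
    · have h₁ := hE s j hj y hpar
      rw [hEnonpos s h] at h₁
      simp only [show s.toNat = 0 by omega, Nat.cast_zero, hEnonpos 0 le_rfl]
      tauto
    · have h₁ := hE s j hj y hpar
      simp only [Int.toNat_of_nonneg h.le]
      tauto

lemma exists_corresponds_left (ha : IsLowValleyed a) (he : IsMaxMultichain (k + 1) a e) :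
    ∃ c, IsSmallChain (prependDown k a) c ∧ Corresponds k a c e := by
  have hl := length_prependDown k a
  let R : ℕ → ℕ → ℤ → Prop := fun i J Y => Y ≤ J ∧ (Y ≤ J - 2 ∨ J ≤ i) ∧
    ∀ j, J = j + k + 1 → Y ≤ J - 2 → Y - k + 1 ≤ ht (e (i - Y + k + 1).toNat) j
  have hmono : ∀ i J Y, J ≤ a.length + k + 1 → R i J Y → R (i + 1) J Y := by
    rintro i J Y hJ ⟨h₁, h₂, h₃⟩
    refine ⟨h₁, by omega, fun j hj hY => (h₃ j hj hY).trans ?_⟩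
    exact he.ht_mono j (by push_cast; omega)
  have hhopr : ∀ i J Y, J < a.length + k + 1 → R (i + 1) J Y → R i (J + 1) (Y - 1) := by
    rintro i J Y hJ ⟨h₁, h₂, h₃⟩
    refine ⟨by push_cast; omega, by push_cast; omega, fun j hj _ => ?_⟩
    rcases j with _ | j
    · rw [ht_zero]
      omega
    · rcases le_or_gt Y (J - 2) with hY | hY
      · have := h₃ j (by omega) hY
        have := he.ht_succ_cases (i + 1 - Y + k + 1).toNat (j := j) (by omega)
        rw [show (i - (Y - 1) + k + 1).toNat = (((i + 1 : ℕ) : ℤ) - Y + k + 1).toNat by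
          push_cast; congr 1; ring]
        push_cast at *
        omega
      · rw [he.ht_top (by omega) (by omega)]
        push_cast
        omega
  have hhopl : ∀ i J Y, J < a.length + k + 1 → R (i + 1) (J + 1) Y → R i J (Y - 1) := by
    rintro i J Y hJ ⟨h₁, h₂, h₃⟩
    push_cast at h₁ h₂
    refine ⟨by omega, by omega, fun j hj hY => ?_⟩
    have := h₃ (j + 1) (by omega) (by push_cast; omega)
    have := he.ht_succ_cases (i + 1 - Y + k + 1).toNat (j := j) (by omega)
    rw [show (i - (Y - 1) + k + 1).toNat = (((i + 1 : ℕ) : ℤ) - Y + k + 1).toNat by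
      push_cast; congr 1; ring]
    push_cast at *
    omega
  have hex : ∀ i : ℕ, ∃ p : BinPath, p.length = a.length + k + 1 ∧
      ∀ J ≤ a.length + k + 1, ∀ Y : ℤ, (Y - J) % 2 = 0 → (Y ≤ ht p J ↔ R i J Y) := by
    intro i
    refine exists_path_of_predicate _ (R i) (fun J Y hJ hY => ⟨by omega, by omega, ?_⟩)
      (fun Y hY h => absurd h.1 (by push_cast; omega))
      (fun J Y hJ h => hhopr i J Y hJ (hmono i J Y hJ.le h))
      (fun J Y hJ h => hhopl i J Y hJ (hmono i (J + 1) Y hJ h))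
    intro j hj _
    have := (he.ht_bounds (i - Y + k + 1).toNat (j := j) (by omega)).1
    omega
  choose C hClen hC using hex
  have hpar : ∀ i {J}, J ≤ a.length + k + 1 → (ht (C i) J - J) % 2 = 0 := fun i J hJ =>
    (ht_bounds (C i) (by rwa [hClen])).2.2
  have hlow : ∀ j ≤ a.length, ∀ y : ℤ, (y - j) % 2 = 0 → y ≤ 1 → y ≤ ht a j := by
    intro j hj y hy hy₁
    have h₁ := ha.nonneg j hj
    have h₂ := (ht_bounds a hj).2.2
    omega
  have hcell : ∀ j ≤ a.length, ∀ y : ℤ, y ≤ j → (y - j) % 2 = 0 → ∀ s : ℤ,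
      (y + k - 1 ≤ ht (C (y + s - 2).toNat) (j + k + 1) ↔ y ≤ ht (e s.toNat) j) := by
    intro j hj y hy hpar s
    rw [hC _ (j + k + 1) (by omega) _ (by push_cast; omega)]
    constructor
    · rintro ⟨-, -, h⟩
      have h := h j rfl (by push_cast; omega)
      rcases le_or_gt y 1 with hy₁ | hy₁
      · exact (hlow j hj y hpar hy₁).trans (he.le_ht _ _)
      · rcases le_or_gt 0 (y + s - 2) with hs | hs
        · rw [Int.toNat_of_nonneg hs,
            show y + s - 2 - (y + k - 1) + k + 1 = s by ring] at h
          omega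
        · rw [show (((y + s - 2).toNat : ℤ) - (y + k - 1) + k + 1).toNat = s.toNat by omega] at h
          omega
    · intro h
      refine ⟨by push_cast; omega, by push_cast; omega, fun j' hj' _ => ?_⟩
      obtain rfl : j' = j := by omega
      have := he.ht_mono j' (show s.toNat ≤
        (((y + s - 2).toNat : ℤ) - (y + k - 1) + k + 1).toNat by omega)
      simp only at this
      omega
  refine ⟨C, ⟨?_, fun i hi => ?_, fun i => ?_, fun i => ?_⟩, hcell⟩
  · refine eq_of_ht_eq (by rw [hClen, hl]) fun J hJ => ?_
    rw [hClen] at hJ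
    rcases J with _ | J
    · rw [ht_zero, ht_zero]
    · have hup := ((hC 0 _ hJ _ (hpar 0 hJ)).1 le_rfl).2.1.resolve_right (by omega)
      push_cast at hup
      rcases lt_or_ge J k with hJk | hJk
      · rw [ht_prependDown_succ k a hJk.le]
        have hlo := (hC 0 (J + 1) hJ (J - 1) (by push_cast; omega)).2
          ⟨by push_cast; omega, by push_cast; omega, fun _ _ _ => by omega⟩
        omega
      · obtain ⟨t, rfl⟩ : ∃ t, J = t + k := ⟨J - k, by omega⟩
        rw [ht_prependDown_right]
        have hp := hpar 0 hJ
        have hb := ht_bounds a (j := t) (by omega)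
        set Y := ht (C 0) (t + k + 1) with hY
        push_cast at hp hup
        have h₁ := (hcell t (by omega) (Y - k + 1) (by omega) (by omega) (2 - (Y - k + 1))).1
        have h₂ := (hcell t (by omega) (ht a t) hb.2.1 hb.2.2 (2 - ht a t)).2
        rw [show (Y - k + 1 + (2 - (Y - k + 1)) - 2).toNat = 0 by omega] at h₁
        rw [show (ht a t + (2 - ht a t) - 2).toNat = 0 by omega] at h₂
        have h₂ := h₂ (he.le_ht _ _)
        have h₁ := h₁ (by omega)
        have h₃ : Y - k + 1 ≤ ht a t := by
          rcases le_or_gt (Y - k + 1) 1 with hY₁ | hY₁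
          · exact hlow t (by omega) _ (by omega) hY₁
          · rwa [show (2 - (Y - k + 1)).toNat = 0 by omega, he.zero] at h₁
        omega
  · rw [hl] at hi ⊢
    rw [← hClen i]
    refine eq_maxPath fun J hJ => ?_
    rw [hClen] at hJ
    exact (hC i J hJ J (by simp)).2 ⟨le_rfl, by omega, fun _ _ h => by omega⟩
  · refine pathLe_iff.2 ⟨by rw [hClen, hClen], fun J hJ => ?_⟩
    rw [hClen] at hJ
    exact (hC _ J hJ _ (hpar i hJ)).2 (hmono _ _ _ hJ ((hC i J hJ _ (hpar i hJ)).1 le_rfl))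
  · refine pathLe_fill_iff.2 ⟨by rw [hClen, hClen], fun J hJ => ?_⟩
    rw [hClen] at hJ
    have h₁ := hpar (i + 1) hJ.le
    have h₂ := hpar (i + 1) (J := J + 1) hJ
    constructor
    · have := (hC i (J + 1) hJ _ (by push_cast; omega)).2
        (hhopr i J _ hJ ((hC (i + 1) J hJ.le _ h₁).1 le_rfl))
      omega
    · have := (hC i J hJ.le _ (by push_cast at h₂; omega)).2
        (hhopl i J _ hJ ((hC (i + 1) (J + 1) hJ _ h₂).1 le_rfl))
      omega

end Correspondence

/-- If the Dyck path `a` is a product of pyramids, then for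
every `k ≥ 1`, `f(d u^k a) = ζ^{k+1}(a, u^{|a|})`, the number of multichains of
length `k+1` from `a` to the maximum path `u^{|a|}`. -/
theorem statement19 (a : BinPath) (hA : ∃ L : List ℕ, a = (L.map pyramid).flatten)
    (k : ℕ) (hk : 1 ≤ k) :
    fPath (false :: (List.replicate k true ++ a))
      = zetaPow (k + 1) a (maxPath a.length) := by
  obtain ⟨L, hL⟩ := hA
  have ha : IsLowValleyed a := hL ▸ isLowValleyed_flatten_pyramids L
  choose! F hF hFc using fun c (hc : IsSmallChain (prependDown k a) c) =>
    exists_corresponds_right ha hc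
  choose! G hG hGc using fun e (he : IsMaxMultichain (k + 1) a e) =>
    exists_corresponds_left ha he
  obtain ⟨e₀, he₀⟩ : ∃ e, IsMaxMultichain (k + 1) a e := by
    refine ⟨fun i => if i = 0 then a else maxPath a.length, if_pos rfl,
      fun i hi => if_neg (by omega), fun i => ?_⟩
    rw [if_neg (Nat.succ_ne_zero i)]
    split_ifs
    · refine pathLe_iff.2 ⟨(length_maxPath _).symm, fun j hj => ?_⟩
      rw [ht_maxPath hj]
      exact (ht_bounds a hj).2.1
    · exact pathLe_refl _
  rw [zetaPow_maxPath_eq_ncard,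
    fPath_eq_ncard_isSmallChain (ht_prependDown_one k a) ⟨_, hG _ he₀⟩]
  refine Set.ncard_congr (fun c _ => F c) (fun c hc => hF c hc) (fun c c' hc hc' h => ?_)
    fun e he => ⟨G e, hG e he, ?_⟩
  · exact (hFc c hc).left_unique hc hc' (by simpa only [h] using hFc c' hc')
  · exact (hFc _ (hG e he)).right_unique (hF _ (hG e he)) he (hGc e he)
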